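/- arXiv:2310.06600 — 4 statements merged into one kernel-verified Lean document; each statement's English description precedes it below -/
import Mathlib

section
/- Let n = n1 + n2 with n1, n2 positive integers, X an n × d real matrix with Q = XᵀX invertible, A an n × m real matrix, w* ∈ ℝ^d, v* ∈ ℝ^m, σ > 0, and γ* the n × n diagonal matrix whose first n1 diagonal entries are 1 and last n2 diagonal entries are 0. Let ε ~ N(0, σ² I_n) and y = γ* X w* + (I − γ*) A v* + ε. Set δ* = X w* − A v*, Π_x = X Q^{-1} Xᵀ, Q1 = Xᵀ γ* X, and define the OLS estimator w0 = Q^{-1} Xᵀ y and the risk R(θ) = (1/n1) ‖γ* X (θ − w*)‖² + σ². Then E_ε[ R(w0) ] = (1/n1) ‖γ* Π_x (I − γ*) δ*‖² + (σ²/n1) tr( Q^{-1} Q1 ) + σ². -/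
open MeasureTheory ProbabilityTheory Matrix

/-- Second moment of an affine functional of centred Gaussian noise with i.i.d. coordinates. -/
theorem integral_sq_const_add_sum_gaussian {ι : Type*} [Fintype ι] (s : NNReal) (b : ℝ)
    (a : ι → ℝ) :
    Integrable (fun ε : ι → ℝ => (b + ∑ j, a j * ε j) ^ 2)
        (Measure.pi fun _ : ι => gaussianReal 0 s) ∧
      ∫ ε : ι → ℝ, (b + ∑ j, a j * ε j) ^ 2 ∂(Measure.pi fun _ : ι => gaussianReal 0 s)
        = b ^ 2 + s * ∑ j, a j ^ 2 := by
  set μ : Measure (ι → ℝ) := Measure.pi fun _ : ι => gaussianReal 0 s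
  have hid : MemLp (fun x : ℝ => x) 2 (gaussianReal 0 s) := memLp_id_gaussianReal 2
  have hcoord (j : ι) : MemLp (fun ε : ι → ℝ => a j * ε j) 2 μ :=
    (hid.comp_measurePreserving
      (measurePreserving_eval (fun _ : ι => gaussianReal 0 s) j)).const_mul (a j)
  have hsum : MemLp (fun ε : ι → ℝ => ∑ j, a j * ε j) 2 μ :=
    memLp_finsetSum Finset.univ fun j _ => hcoord j
  have hZ : MemLp (fun ε : ι → ℝ => b + ∑ j, a j * ε j) 2 μ := (memLp_const b).add hsum
  have hmean : ∫ ε, (b + ∑ j, a j * ε j) ∂μ = b := by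
    rw [integral_add (integrable_const b) (hsum.integrable one_le_two),
      integral_finsetSum _ fun j _ => (hcoord j).integrable one_le_two]
    have hzero (j : ι) : ∫ ε, a j * ε j ∂μ = 0 := by
      rw [integral_const_mul, integral_comp_eval (μ := fun _ : ι => gaussianReal 0 s)
        (f := fun x : ℝ => x) (i := j) hid.aestronglyMeasurable, integral_id_gaussianReal,
        mul_zero]
    simp [hzero]
  have hvar : Var[fun ε : ι → ℝ => b + ∑ j, a j * ε j; μ] = s * ∑ j, a j ^ 2 := by
    rw [variance_const_add hsum.aestronglyMeasurable]
    have h := variance_sum_pi (μ := fun _ : ι => gaussianReal 0 s)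
      (X := fun j x => a j * x) fun j => hid.const_mul (a j)
    have hfun : (fun ε : ι → ℝ => ∑ j, a j * ε j) = ∑ j, fun ε : ι → ℝ => a j * ε j := by
      ext ε
      simp
    rw [hfun, h, Finset.mul_sum]
    refine Finset.sum_congr rfl fun j _ => ?_
    rw [variance_const_mul, variance_fun_id_gaussianReal, mul_comm]
  refine ⟨hZ.integrable_sq, ?_⟩
  have h := variance_eq_sub hZ
  rw [hvar, hmean] at h
  simp only [Pi.pow_apply] at h
  linarith

/-- Bias-variance decomposition for an affine image of centred Gaussian noise. -/
theorem integral_sum_sq_add_mulVec_gaussian {ι κ : Type*} [Fintype ι] [Fintype κ]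
    (s : NNReal) (b : κ → ℝ) (M : Matrix κ ι ℝ) :
    Integrable (fun ε : ι → ℝ => ∑ i, (b i + (M *ᵥ ε) i) ^ 2)
        (Measure.pi fun _ : ι => gaussianReal 0 s) ∧
      ∫ ε : ι → ℝ, ∑ i, (b i + (M *ᵥ ε) i) ^ 2 ∂(Measure.pi fun _ : ι => gaussianReal 0 s)
        = ∑ i, b i ^ 2 + s * (M * Mᵀ).trace := by
  have h (i : κ) := integral_sq_const_add_sum_gaussian s (b i) (M i)
  simp only [mulVec, dotProduct]
  refine ⟨integrable_finsetSum _ fun i _ => (h i).1, ?_⟩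
  rw [integral_finsetSum _ fun i _ => (h i).1]
  simp only [(h _).2, Finset.sum_add_distrib, ← Finset.mul_sum, trace, diag, mul_apply,
    transpose_apply, ← sq]

/-- Risk of the OLS estimator:
`E_ε[R(w0)] = (1/n1) ‖γ* Π_x (I − γ*) δ*‖² + (σ²/n1) tr(Q⁻¹ Q1) + σ²`. -/
theorem ols_risk
    (n1 n2 d m : ℕ) (hn1 : 0 < n1) (hn2 : 0 < n2)
    (X : Matrix (Fin (n1 + n2)) (Fin d) ℝ)
    (A : Matrix (Fin (n1 + n2)) (Fin m) ℝ)
    (ws : Fin d → ℝ) (vs : Fin m → ℝ) (σ : ℝ) (hσ : 0 < σ)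
    (γs : Matrix (Fin (n1 + n2)) (Fin (n1 + n2)) ℝ)
    (hγ : γs = Matrix.diagonal (fun i : Fin (n1 + n2) =>
      if (i : ℕ) < n1 then (1 : ℝ) else 0))
    (Q : Matrix (Fin d) (Fin d) ℝ) (hQ : Q = Xᵀ * X) (hQinv : IsUnit Q.det)
    (δs : Fin (n1 + n2) → ℝ) (hδ : δs = X.mulVec ws - A.mulVec vs)
    (Px : Matrix (Fin (n1 + n2)) (Fin (n1 + n2)) ℝ) (hP : Px = X * Q⁻¹ * Xᵀ)
    (Q1 : Matrix (Fin d) (Fin d) ℝ) (hQ1 : Q1 = Xᵀ * γs * X)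
    (y : (Fin (n1 + n2) → ℝ) → Fin (n1 + n2) → ℝ)
    (hy : ∀ ε, y ε = (γs * X).mulVec ws + ((1 - γs) * A).mulVec vs + ε)
    (w0 : (Fin (n1 + n2) → ℝ) → Fin d → ℝ)
    (hw0 : ∀ ε, w0 ε = (Q⁻¹ * Xᵀ).mulVec (y ε))
    (R : (Fin d → ℝ) → ℝ)
    (hR : ∀ θ, R θ = ((1 : ℝ) / n1) * ∑ i, ((γs * X).mulVec (θ - ws) i) ^ 2 + σ ^ 2) :
    ∫ ε : Fin (n1 + n2) → ℝ, R (w0 ε)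
      ∂(Measure.pi fun _ : Fin (n1 + n2) => gaussianReal 0 ⟨σ ^ 2, sq_nonneg σ⟩)
    = ((1 : ℝ) / n1) * ∑ i, ((γs * Px * (1 - γs)).mulVec δs i) ^ 2
      + (σ ^ 2 / n1) * (Q⁻¹ * Q1).trace + σ ^ 2 := by
  have hγt : γsᵀ = γs := by rw [hγ, diagonal_transpose]
  have hγγ : γs * γs = γs := by
    rw [hγ, diagonal_mul_diagonal]
    congr 1
    ext i
    split_ifs <;> simp
  have hQt : Qᵀ = Q := by rw [hQ, transpose_mul, transpose_transpose]
  have hPt : Pxᵀ = Px := by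
    rw [hP]
    simp only [transpose_mul, transpose_transpose, transpose_nonsing_inv, hQt, Matrix.mul_assoc]
  have hPX : Px * X = X := by
    rw [hP, Matrix.mul_assoc, ← hQ, Matrix.mul_assoc, nonsing_inv_mul Q hQinv, Matrix.mul_one]
  have hPP : Px * Px = Px := by
    conv_lhs => rw [hP, ← Matrix.mul_assoc, ← Matrix.mul_assoc, ← hP, hPX, ← hP]
  have hresidual (ε : Fin (n1 + n2) → ℝ) : (γs * X) *ᵥ (w0 ε - ws)
      = -((γs * Px * (1 - γs)) *ᵥ δs) + (γs * Px) *ᵥ ε := by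
    have hfit : (γs * X) *ᵥ w0 ε = (γs * Px) *ᵥ y ε := by
      rw [hw0, mulVec_mulVec, hP]
      simp only [Matrix.mul_assoc]
    have hXw : (γs * X) *ᵥ ws = (γs * Px) *ᵥ (X *ᵥ ws) := by
      rw [mulVec_mulVec, Matrix.mul_assoc, hPX]
    rw [mulVec_sub, hfit, hXw, hy, hδ]
    simp only [← mulVec_mulVec, mulVec_add, mulVec_sub, sub_mulVec, one_mulVec]
    abel
  have htrace : ((γs * Px) * (γs * Px)ᵀ).trace = (Q⁻¹ * Q1).trace := by
    rw [transpose_mul, hPt, hγt, Matrix.mul_assoc, ← Matrix.mul_assoc Px, hPP, trace_mul_comm,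
      Matrix.mul_assoc, hγγ, hP, hQ1, Matrix.mul_assoc, Matrix.mul_assoc, trace_mul_comm]
    simp only [Matrix.mul_assoc]
  obtain ⟨s, hs⟩ : ∃ s : NNReal, s = ⟨σ ^ 2, sq_nonneg σ⟩ := ⟨_, rfl⟩
  have hsσ : (s : ℝ) = σ ^ 2 := congrArg NNReal.toReal hs
  rw [← hs]
  obtain ⟨hint, hval⟩ := integral_sum_sq_add_mulVec_gaussian s
    (-((γs * Px * (1 - γs)) *ᵥ δs)) (γs * Px)
  simp only [hR, hresidual, Pi.add_apply]
  rw [integral_add (hint.const_mul _) (integrable_const _), integral_const_mul, hval, htrace]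
  simp only [integral_const, probReal_univ, one_smul, Pi.neg_apply, neg_sq, hsσ]
  ring
end

section
/- Let X be an n × d real matrix, A an n × m real matrix, w* ∈ ℝ^d, v* ∈ ℝ^m, ε ∈ ℝ^n, and γ*, γ n × n real diagonal matrices. Set δ* = X w* − A v*, Δ_γ = γ* − γ, X̄ = γ X, Ā = (I − γ) A, and assume ĀᵀĀ is invertible. Let Π̄_a = Ā (ĀᵀĀ)^{-1} Āᵀ, X̄_a = (I − Π̄_a) X̄, assume Q̄_a = X̄_aᵀ X̄_a is invertible, and let H̄ = Q̄_a^{-1} X̄_aᵀ. Then for y = γ* X w* + (I − γ*) A v* + ε, the Pi-DUAL estimator w1 = H̄ y satisfies w1 = w* + H̄ Δ_γ δ* + H̄ ε. -/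
open Matrix

theorem residual_transpose_mul_eq_zero {ι κ μ : Type*} [Fintype ι] [Fintype κ]
    [DecidableEq ι] [DecidableEq κ] {R : Type*} [CommRing R]
    (B : Matrix ι κ R) (C : Matrix ι μ R) (hB : IsUnit (Bᵀ * B).det) :
    ((1 - B * (Bᵀ * B)⁻¹ * Bᵀ) * C)ᵀ * B = 0 := by
  have hsymm : (B * (Bᵀ * B)⁻¹ * Bᵀ)ᵀ = B * (Bᵀ * B)⁻¹ * Bᵀ := by
    simp [transpose_mul, transpose_nonsing_inv, Matrix.mul_assoc]
  have hfix : B * (Bᵀ * B)⁻¹ * Bᵀ * B = B := by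
    rw [Matrix.mul_assoc, Matrix.mul_assoc, nonsing_inv_mul _ hB, Matrix.mul_one]
  rw [transpose_mul, transpose_sub, transpose_one, hsymm, Matrix.mul_assoc, Matrix.sub_mul,
    Matrix.one_mul, hfix, sub_self, Matrix.mul_zero]

/-- Decomposition of the Pi-DUAL estimator:
`w1 = H̄ y = w* + H̄ Δ_γ δ* + H̄ ε`. -/
theorem pidual_estimator_decomposition
    (n d m : ℕ)
    (X : Matrix (Fin n) (Fin d) ℝ) (A : Matrix (Fin n) (Fin m) ℝ)
    (ws : Fin d → ℝ) (vs : Fin m → ℝ) (ε : Fin n → ℝ)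
    (γs γ : Matrix (Fin n) (Fin n) ℝ) (hγs : γs.IsDiag) (hγd : γ.IsDiag)
    (δs : Fin n → ℝ) (hδ : δs = X.mulVec ws - A.mulVec vs)
    (Δγ : Matrix (Fin n) (Fin n) ℝ) (hΔ : Δγ = γs - γ)
    (Xb : Matrix (Fin n) (Fin d) ℝ) (hXb : Xb = γ * X)
    (Ab : Matrix (Fin n) (Fin m) ℝ) (hAb : Ab = (1 - γ) * A)
    (hAinv : IsUnit (Abᵀ * Ab).det)
    (Pa : Matrix (Fin n) (Fin n) ℝ) (hPa : Pa = Ab * (Abᵀ * Ab)⁻¹ * Abᵀ)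
    (Xa : Matrix (Fin n) (Fin d) ℝ) (hXa : Xa = (1 - Pa) * Xb)
    (Qa : Matrix (Fin d) (Fin d) ℝ) (hQa : Qa = Xaᵀ * Xa) (hQainv : IsUnit Qa.det)
    (H : Matrix (Fin d) (Fin n) ℝ) (hH : H = Qa⁻¹ * Xaᵀ)
    (y : Fin n → ℝ)
    (hy : y = (γs * X).mulVec ws + ((1 - γs) * A).mulVec vs + ε)
    (w1 : Fin d → ℝ) (hw1 : w1 = H.mulVec y) :
    w1 = ws + (H * Δγ).mulVec δs + H.mulVec ε := by
  have hXaAb : Xaᵀ * Ab = 0 := by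
    rw [hXa, hPa]
    exact residual_transpose_mul_eq_zero Ab Xb hAinv
  have hHAb : H * Ab = 0 := by rw [hH, Matrix.mul_assoc, hXaAb, Matrix.mul_zero]
  have hXaPa : Xaᵀ * Pa = 0 := by
    rw [hPa, ← Matrix.mul_assoc, ← Matrix.mul_assoc, hXaAb, Matrix.zero_mul, Matrix.zero_mul]
  have hXaXb : Xaᵀ * Xb = Qa := by
    have h : Xaᵀ * Xa = Xaᵀ * ((1 - Pa) * Xb) := congrArg (Xaᵀ * ·) hXa
    rw [hQa, h, ← Matrix.mul_assoc, Matrix.mul_sub, Matrix.mul_one, hXaPa, sub_zero]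
  have hHXb : H * Xb = 1 := by rw [hH, Matrix.mul_assoc, hXaXb, nonsing_inv_mul _ hQainv]
  have hy' : y = Xb *ᵥ ws + Ab *ᵥ vs + Δγ *ᵥ δs + ε := by
    rw [hy, hXb, hAb, hΔ, hδ]
    simp only [← mulVec_mulVec, sub_mulVec, mulVec_sub, one_mulVec]
    abel
  rw [hw1, hy']
  simp only [mulVec_add, mulVec_mulVec, hHXb, hHAb, one_mulVec, zero_mulVec, add_zero]
end

section
/- Let n = n1 + n2 with n1, n2 positive integers, X an n × d real matrix with Q = XᵀX invertible, A an n × m real matrix, w* ∈ ℝ^d, v* ∈ ℝ^m, σ > 0, and γ* the n × n diagonal matrix whose first n1 diagonal entries are 1 and last n2 diagonal entries are 0. Let ε ~ N(0, σ² I_n) and y = γ* X w* + (I − γ*) A v* + ε. Let γ be an n × n diagonal matrix with diagonal entries in {0, 1}; set δ* = X w* − A v*, Δ_γ = γ* − γ, Π_x = X Q^{-1} Xᵀ, Q1 = Xᵀ γ* X, X̄ = γ X, Ā = (I − γ) A, assume ĀᵀĀ invertible, let Π̄_a = Ā (ĀᵀĀ)^{-1} Āᵀ, X̄_a = (I − Π̄_a)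 X̄, assume Q̄_a = X̄_aᵀ X̄_a invertible, and let H̄ = Q̄_a^{-1} X̄_aᵀ. Define the OLS estimator w0 = Q^{-1} Xᵀ y, the Pi-DUAL estimator w1 = H̄ y, and the risk R(θ) = (1/n1) ‖γ* X (θ − w*)‖² + σ². Then E_ε[ R(w0) ] > E_ε[ R(w1) ] if and only if ‖γ* Π_x (I − γ*) δ*‖² + σ² tr( Q^{-1} Q1 ) > ‖γ* X H̄ Δ_γ δ*‖² + σ² tr( Q̄_a^{-1} Q1 ). -/
open MeasureTheory ProbabilityTheory Matrix

/-- Second moment of an affine form in independent centred variables of common variance `v`. -/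
lemma integral_sq_affine_pi {ι : Type*} [Fintype ι] {ν : Measure ℝ} [IsProbabilityMeasure ν]
    (hν : MemLp id 2 ν) (hmean : ∫ x, x ∂ν = 0) (b : ℝ) (a : ι → ℝ) :
    Integrable (fun ε : ι → ℝ => (b + ∑ j, a j * ε j) ^ 2) (Measure.pi fun _ => ν) ∧
    ∫ ε : ι → ℝ, (b + ∑ j, a j * ε j) ^ 2 ∂(Measure.pi fun _ => ν)
      = b ^ 2 + variance id ν * ∑ j, a j ^ 2 := by
  have hcoord (j : ι) : MemLp (fun ε : ι → ℝ => a j * ε j) 2 (Measure.pi fun _ => ν) :=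
    (hν.comp_measurePreserving (measurePreserving_eval (fun _ : ι => ν) j)).const_mul (a j)
  have hsum : MemLp (fun ε : ι → ℝ => ∑ j, a j * ε j) 2 (Measure.pi fun _ => ν) :=
    memLp_finsetSum _ fun j _ => hcoord j
  have haff : MemLp (fun ε : ι → ℝ => b + ∑ j, a j * ε j) 2 (Measure.pi fun _ => ν) :=
    (memLp_const b).add hsum
  have hsum_mean : ∫ ε : ι → ℝ, ∑ j, a j * ε j ∂(Measure.pi fun _ => ν) = 0 := by
    rw [integral_finsetSum _ fun j _ => (hcoord j).integrable (by norm_num)]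
    refine Finset.sum_eq_zero fun j _ => ?_
    rw [integral_const_mul, integral_comp_eval (μ := fun _ : ι => ν) (i := j) (f := fun x => x)
      aestronglyMeasurable_id, hmean, mul_zero]
  have haff_mean : ∫ ε : ι → ℝ, (b + ∑ j, a j * ε j) ∂(Measure.pi fun _ => ν) = b := by
    rw [integral_add (integrable_const b) (hsum.integrable (by norm_num)), hsum_mean]
    simp
  have hvar : variance (fun ε : ι → ℝ => b + ∑ j, a j * ε j) (Measure.pi fun _ => ν)
      = variance id ν * ∑ j, a j ^ 2 := by
    have h := variance_sum_pi (μ := fun _ : ι => ν) (X := fun j x => a j * x)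
      fun j => hν.const_mul (a j)
    rw [variance_const_add hsum.aestronglyMeasurable, Finset.mul_sum]
    convert h using 2
    · ext ε; simp
    · next j => rw [variance_const_mul, mul_comm]; rfl
  refine ⟨haff.integrable_sq, ?_⟩
  have h := variance_eq_sub haff
  simp only [Pi.pow_apply] at h
  rw [haff_mean, hvar] at h
  linarith

/-- Bias-variance decomposition of the expected squared norm of an affine image of centred
Gaussian noise with covariance `v • 1`. -/
lemma integral_sum_sq_affine_gaussian {ι κ : Type*} [Fintype ι] [Fintype κ] (v : NNReal)
    (b : κ → ℝ) (M : Matrix κ ι ℝ) :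
    Integrable (fun ε : ι → ℝ => ∑ i, ((b + M *ᵥ ε) i) ^ 2)
      (Measure.pi fun _ => gaussianReal 0 v) ∧
    ∫ ε : ι → ℝ, ∑ i, ((b + M *ᵥ ε) i) ^ 2 ∂(Measure.pi fun _ => gaussianReal 0 v)
      = ∑ i, b i ^ 2 + v * (M * Mᵀ).trace := by
  have h (i : κ) := integral_sq_affine_pi (memLp_id_gaussianReal (μ := 0) (v := v) 2)
    integral_id_gaussianReal (b i) (M i)
  simp only [Pi.add_apply, mulVec, dotProduct]
  refine ⟨integrable_finsetSum _ fun i _ => (h i).1, ?_⟩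
  rw [integral_finsetSum _ fun i _ => (h i).1, Finset.sum_congr rfl fun i _ => (h i).2,
    Finset.sum_add_distrib, ← Finset.mul_sum, variance_id_gaussianReal]
  simp [Matrix.trace, Matrix.mul_apply, sq]

/-- Expected risk of the linear estimator `ε ↦ L (y₀ + ε)`, evaluated through a symmetric
idempotent mask `G`. -/
lemma integral_risk_linear_estimator {ι κ : Type*} [Fintype ι] [Fintype κ]
    (v : NNReal) (c s : ℝ) (G : Matrix ι ι ℝ) (hGt : Gᵀ = G) (hG : G * G = G)
    (X : Matrix ι κ ℝ) (L : Matrix κ ι ℝ) (y₀ : ι → ℝ) (ws : κ → ℝ) :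
    ∫ ε : ι → ℝ, (c * ∑ i, ((G * X) *ᵥ (L *ᵥ (y₀ + ε) - ws)) i ^ 2 + s)
        ∂(Measure.pi fun _ => gaussianReal 0 v)
      = c * (∑ i, ((G * X) *ᵥ (L *ᵥ y₀ - ws)) i ^ 2
          + v * ((L * Lᵀ) * (Xᵀ * G * X)).trace) + s := by
  have haff (ε : ι → ℝ) : (G * X) *ᵥ (L *ᵥ (y₀ + ε) - ws)
      = (G * X) *ᵥ (L *ᵥ y₀ - ws) + (G * X * L) *ᵥ ε := by
    rw [← mulVec_mulVec ε, ← mulVec_add, mulVec_add L]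
    congr 1
    abel
  have htrace : ((G * X * L) * (G * X * L)ᵀ).trace = ((L * Lᵀ) * (Xᵀ * G * X)).trace := by
    have : (G * X * L) * (G * X * L)ᵀ = (G * X) * ((L * Lᵀ) * (Xᵀ * G)) := by
      simp only [transpose_mul, hGt, Matrix.mul_assoc]
    rw [this, Matrix.trace_mul_comm]
    congr 1
    calc L * Lᵀ * (Xᵀ * G) * (G * X) = L * Lᵀ * (Xᵀ * (G * G) * X) := by
          simp only [Matrix.mul_assoc]
      _ = _ := by rw [hG]
  obtain ⟨hint, hval⟩ := integral_sum_sq_affine_gaussian v ((G * X) *ᵥ (L *ᵥ y₀ - ws)) (G * X * L)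
  simp only [haff]
  rw [integral_add (hint.const_mul c) (integrable_const s), integral_const_mul, hval, htrace]
  simp

/-- The least-squares map `(YᵀY)⁻¹ Yᵀ` satisfies `L Lᵀ = (YᵀY)⁻¹`. -/
lemma leastSquares_mul_transpose {ι κ : Type*} [Fintype ι] [Fintype κ] [DecidableEq κ]
    (Y : Matrix ι κ ℝ) (h : IsUnit (Yᵀ * Y).det) :
    ((Yᵀ * Y)⁻¹ * Yᵀ) * ((Yᵀ * Y)⁻¹ * Yᵀ)ᵀ = (Yᵀ * Y)⁻¹ := by
  rw [transpose_mul, transpose_transpose, transpose_nonsing_inv, transpose_mul,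
    transpose_transpose, Matrix.mul_assoc, ← Matrix.mul_assoc Yᵀ, mul_nonsing_inv _ h,
    Matrix.mul_one]

/-- main Proposition: `E_ε[R(w0)] > E_ε[R(w1)]` iff
`‖γ* Π_x (I − γ*) δ*‖² + σ² tr(Q⁻¹ Q1) > ‖γ* X H̄ Δ_γ δ*‖² + σ² tr(Q̄_a⁻¹ Q1)`. -/
theorem ols_vs_pidual_risk_comparison
    (n1 n2 d m : ℕ) (hn1 : 0 < n1) (hn2 : 0 < n2)
    (X : Matrix (Fin (n1 + n2)) (Fin d) ℝ)
    (A : Matrix (Fin (n1 + n2)) (Fin m) ℝ)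
    (ws : Fin d → ℝ) (vs : Fin m → ℝ) (σ : ℝ) (hσ : 0 < σ)
    (γs : Matrix (Fin (n1 + n2)) (Fin (n1 + n2)) ℝ)
    (hγs : γs = Matrix.diagonal (fun i : Fin (n1 + n2) =>
      if (i : ℕ) < n1 then (1 : ℝ) else 0))
    (g : Fin (n1 + n2) → ℝ) (hg : ∀ i, g i = 0 ∨ g i = 1)
    (γ : Matrix (Fin (n1 + n2)) (Fin (n1 + n2)) ℝ) (hγ : γ = Matrix.diagonal g)
    (Q : Matrix (Fin d) (Fin d) ℝ) (hQ : Q = Xᵀ * X) (hQinv : IsUnit Q.det)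
    (δs : Fin (n1 + n2) → ℝ) (hδ : δs = X.mulVec ws - A.mulVec vs)
    (Δγ : Matrix (Fin (n1 + n2)) (Fin (n1 + n2)) ℝ) (hΔ : Δγ = γs - γ)
    (Px : Matrix (Fin (n1 + n2)) (Fin (n1 + n2)) ℝ) (hPx : Px = X * Q⁻¹ * Xᵀ)
    (Q1 : Matrix (Fin d) (Fin d) ℝ) (hQ1 : Q1 = Xᵀ * γs * X)
    (Xb : Matrix (Fin (n1 + n2)) (Fin d) ℝ) (hXb : Xb = γ * X)
    (Ab : Matrix (Fin (n1 + n2)) (Fin m) ℝ) (hAb : Ab = (1 - γ) * A)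
    (hAinv : IsUnit (Abᵀ * Ab).det)
    (Pa : Matrix (Fin (n1 + n2)) (Fin (n1 + n2)) ℝ)
    (hPa : Pa = Ab * (Abᵀ * Ab)⁻¹ * Abᵀ)
    (Xa : Matrix (Fin (n1 + n2)) (Fin d) ℝ) (hXa : Xa = (1 - Pa) * Xb)
    (Qa : Matrix (Fin d) (Fin d) ℝ) (hQa : Qa = Xaᵀ * Xa) (hQainv : IsUnit Qa.det)
    (H : Matrix (Fin d) (Fin (n1 + n2)) ℝ) (hH : H = Qa⁻¹ * Xaᵀ)
    (y : (Fin (n1 + n2) → ℝ) → Fin (n1 + n2) → ℝ)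
    (hy : ∀ ε, y ε = (γs * X).mulVec ws + ((1 - γs) * A).mulVec vs + ε)
    (w0 : (Fin (n1 + n2) → ℝ) → Fin d → ℝ)
    (hw0 : ∀ ε, w0 ε = (Q⁻¹ * Xᵀ).mulVec (y ε))
    (w1 : (Fin (n1 + n2) → ℝ) → Fin d → ℝ)
    (hw1 : ∀ ε, w1 ε = H.mulVec (y ε))
    (R : (Fin d → ℝ) → ℝ)
    (hR : ∀ θ, R θ = ((1 : ℝ) / n1) * ∑ i, ((γs * X).mulVec (θ - ws) i) ^ 2 + σ ^ 2) :
    (∫ ε : Fin (n1 + n2) → ℝ, R (w0 ε)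
        ∂(Measure.pi fun _ : Fin (n1 + n2) => gaussianReal 0 ⟨σ ^ 2, sq_nonneg σ⟩))
      > (∫ ε : Fin (n1 + n2) → ℝ, R (w1 ε)
        ∂(Measure.pi fun _ : Fin (n1 + n2) => gaussianReal 0 ⟨σ ^ 2, sq_nonneg σ⟩))
    ↔ (∑ i, ((γs * Px * (1 - γs)).mulVec δs i) ^ 2 + σ ^ 2 * (Q⁻¹ * Q1).trace
        > ∑ i, ((γs * X * H * Δγ).mulVec δs i) ^ 2 + σ ^ 2 * (Qa⁻¹ * Q1).trace) := by
  have hGt : γsᵀ = γs := by rw [hγs, diagonal_transpose]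
  have hG : γs * γs = γs := by
    rw [hγs, diagonal_mul_diagonal]
    congr 1
    ext i
    split_ifs <;> simp
  have hmean_y : (γs * X) *ᵥ ws + ((1 - γs) * A) *ᵥ vs = X *ᵥ ws - (1 - γs) *ᵥ δs := by
    simp only [hδ, mulVec_sub, sub_mulVec, ← mulVec_mulVec, one_mulVec]
    abel
  have hbias0 : (γs * X) *ᵥ ((Q⁻¹ * Xᵀ) *ᵥ ((γs * X) *ᵥ ws + ((1 - γs) * A) *ᵥ vs) - ws)
      = -((γs * Px * (1 - γs)) *ᵥ δs) := by
    have hLX : Q⁻¹ * Xᵀ * X = 1 := by rw [Matrix.mul_assoc, ← hQ, nonsing_inv_mul _ hQinv]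
    rw [hmean_y, mulVec_sub (Q⁻¹ * Xᵀ), mulVec_mulVec ws, hLX, one_mulVec, sub_sub_cancel_left,
      mulVec_neg, mulVec_mulVec, mulVec_mulVec, hPx]
    simp only [Matrix.mul_assoc]
  have hPa_t : Paᵀ = Pa := by
    rw [hPa]
    simp only [transpose_mul, transpose_nonsing_inv, transpose_transpose, Matrix.mul_assoc]
  have hPa_Ab : Pa * Ab = Ab := by
    rw [hPa, Matrix.mul_assoc, Matrix.mul_assoc, nonsing_inv_mul _ hAinv, Matrix.mul_one]
  have hPa_sq : Pa * Pa = Pa := by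
    nth_rw 2 [hPa]
    rw [← Matrix.mul_assoc, ← Matrix.mul_assoc, hPa_Ab, ← hPa]
  have hXa_t : Xaᵀ = Xbᵀ * (1 - Pa) := by
    rw [hXa, transpose_mul, transpose_sub, transpose_one, hPa_t]
  have hHXb : H * Xb = 1 := by
    have : Xaᵀ * Xb = Qa := by
      rw [hQa, hXa_t, hXa, Matrix.mul_assoc, Matrix.mul_assoc, ← Matrix.mul_assoc (1 - Pa)]
      congr 2
      simp [Matrix.sub_mul, Matrix.mul_sub, hPa_sq]
    rw [hH, Matrix.mul_assoc, this, nonsing_inv_mul _ hQainv]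
  have hHAb : H * Ab = 0 := by
    rw [hH, hXa_t, Matrix.mul_assoc, Matrix.mul_assoc, Matrix.sub_mul, hPa_Ab, Matrix.one_mul,
      sub_self, Matrix.mul_zero, Matrix.mul_zero]
  have hmean_y' : (γs * X) *ᵥ ws + ((1 - γs) * A) *ᵥ vs = Xb *ᵥ ws + Ab *ᵥ vs + Δγ *ᵥ δs := by
    simp only [hXb, hAb, hΔ, hδ, mulVec_sub, sub_mulVec, ← mulVec_mulVec, one_mulVec]
    abel
  have hbias1 : (γs * X) *ᵥ (H *ᵥ ((γs * X) *ᵥ ws + ((1 - γs) * A) *ᵥ vs) - ws)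
      = (γs * X * H * Δγ) *ᵥ δs := by
    rw [hmean_y', mulVec_add H, mulVec_add H, mulVec_mulVec ws, mulVec_mulVec vs, hHXb, hHAb,
      one_mulVec, zero_mulVec, add_zero, add_sub_cancel_left, mulVec_mulVec, mulVec_mulVec]
  have hcov0 : (Q⁻¹ * Xᵀ) * (Q⁻¹ * Xᵀ)ᵀ = Q⁻¹ := by
    subst hQ
    exact leastSquares_mul_transpose X hQinv
  have hcov1 : H * Hᵀ = Qa⁻¹ := by
    rw [hH, hQa]
    exact leastSquares_mul_transpose Xa (hQa ▸ hQainv)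
  have hc : (0 : ℝ) < 1 / n1 := by positivity
  suffices ∀ v : NNReal, (v : ℝ) = σ ^ 2 →
      ((∫ ε, R (w0 ε) ∂(Measure.pi fun _ => gaussianReal 0 v))
          > ∫ ε, R (w1 ε) ∂(Measure.pi fun _ => gaussianReal 0 v)
      ↔ ∑ i, ((γs * Px * (1 - γs)) *ᵥ δs) i ^ 2 + σ ^ 2 * (Q⁻¹ * Q1).trace
          > ∑ i, ((γs * X * H * Δγ) *ᵥ δs) i ^ 2 + σ ^ 2 * (Qa⁻¹ * Q1).trace) from
    this ⟨σ ^ 2, sq_nonneg σ⟩ rfl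
  intro v hv
  simp only [hR, hw0, hw1, hy]
  rw [integral_risk_linear_estimator _ _ _ γs hGt hG,
    integral_risk_linear_estimator _ _ _ γs hGt hG,
    hbias0, hbias1, hcov0, hcov1, ← hQ1, hv]
  simp only [Pi.neg_apply, neg_sq, gt_iff_lt, add_lt_add_iff_right,
    mul_lt_mul_iff_right₀ hc]
end

section
/- Under the setting of the Pi-DUAL risk formula, if the gate mask equals the ground-truth mask, γ = γ*, then the bias term vanishes and E_ε[ R(w1) ] = (σ²/n1) tr( Q̄_a^{-1} Q1 ) + σ². Precisely: let n = n1 + n2, X ∈ ℝ^{n×d}, A ∈ ℝ^{n×m}, w* ∈ ℝ^d, v* ∈ ℝ^m, σ > 0, γ* the diagonal matrix with first n1 diagonal entries 1 and last n2 entries 0, ε ~ N(0, σ² I_n), y = γ* X w* + (I − γ*) A v* + ε, Q1 = Xᵀ γ* X, X̄ = γ* X, Ā = (I − γ*) A with ĀᵀĀ invertible, Π̄_a = Ā (ĀᵀĀ)^{-1} Āᵀ, X̄_a = (I − Π̄_a) X̄ with Q̄_a = X̄_aᵀ X̄_a invertible, H̄ = Q̄_a^{-1} X̄_aᵀ, w1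 = H̄ y, and R(θ) = (1/n1) ‖γ* X (θ − w*)‖² + σ². Then E_ε[ R(w1) ] = (σ²/n1) tr( Q̄_a^{-1} Q1 ) + σ². -/
open MeasureTheory ProbabilityTheory Matrix

/-- The second moment of a linear functional of a vector with independent centred Gaussian entries
of common variance. -/
lemma integral_sq_dotProduct_pi_gaussianReal {ι : Type*} [Fintype ι] (a : ι → ℝ) (v : NNReal) :
    Integrable (fun ε : ι → ℝ => (a ⬝ᵥ ε) ^ 2) (Measure.pi fun _ : ι => gaussianReal 0 v) ∧
    ∫ ε : ι → ℝ, (a ⬝ᵥ ε) ^ 2 ∂(Measure.pi fun _ : ι => gaussianReal 0 v) =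
      v * (a ⬝ᵥ a) := by
  have hL (i : ι) : MemLp (fun x : ℝ => a i * x) 2 (gaussianReal 0 v) :=
    (memLp_id_gaussianReal 2).const_mul (a i)
  have hL' (i : ι) : MemLp (fun ε : ι → ℝ => a i * ε i) 2
      (Measure.pi fun _ : ι => gaussianReal 0 v) :=
    (hL i).comp_measurePreserving (measurePreserving_eval (fun _ : ι => gaussianReal 0 v) i)
  have hsum : MemLp (fun ε : ι → ℝ => a ⬝ᵥ ε) 2 (Measure.pi fun _ : ι => gaussianReal 0 v) :=
    memLp_finsetSum Finset.univ fun i _ => hL' i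
  refine ⟨hsum.integrable_sq, ?_⟩
  have hmean : ∫ ε : ι → ℝ, a ⬝ᵥ ε ∂(Measure.pi fun _ : ι => gaussianReal 0 v) = 0 := by
    simp only [dotProduct]
    rw [integral_finsetSum _ fun i _ => (hL' i).integrable (by norm_num)]
    refine Finset.sum_eq_zero fun i _ => ?_
    rw [integral_const_mul, integral_comp_eval (μ := fun _ : ι => gaussianReal 0 v)
      (f := fun x : ℝ => x) (by fun_prop)]
    simp
  rw [← variance_of_integral_eq_zero hsum.aemeasurable hmean]
  have h := variance_sum_pi (μ := fun _ : ι => gaussianReal 0 v) hL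
  have he : (fun ε : ι → ℝ => a ⬝ᵥ ε) = ∑ i, fun ε : ι → ℝ => a i * ε i := by
    ext ε
    simp [dotProduct]
  rw [he, h, dotProduct, Finset.mul_sum]
  refine Finset.sum_congr rfl fun i _ => ?_
  rw [variance_const_mul, variance_fun_id_gaussianReal]
  ring

/-- The expected squared norm of the image under `M` of a vector with independent centred Gaussian
entries of common variance. -/
lemma integral_sum_sq_mulVec_pi_gaussianReal {ι κ : Type*} [Fintype ι] [Fintype κ]
    (M : Matrix κ ι ℝ) (v : NNReal) :
    Integrable (fun ε : ι → ℝ => ∑ i, (M *ᵥ ε) i ^ 2)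
      (Measure.pi fun _ : ι => gaussianReal 0 v) ∧
    ∫ ε : ι → ℝ, ∑ i, (M *ᵥ ε) i ^ 2 ∂(Measure.pi fun _ : ι => gaussianReal 0 v) =
      v * (M * Mᵀ).trace := by
  refine ⟨integrable_finsetSum _ fun i _ => (integral_sq_dotProduct_pi_gaussianReal (M i) v).1, ?_⟩
  simp only [mulVec]
  rw [integral_finsetSum _ fun i _ => (integral_sq_dotProduct_pi_gaussianReal (M i) v).1]
  simp only [trace, Finset.mul_sum]
  exact Finset.sum_congr rfl fun i _ => (integral_sq_dotProduct_pi_gaussianReal (M i) v).2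

/-- Pi-DUAL risk with oracle gates `γ = γ*`: the bias vanishes and
`E_ε[R(w1)] = (σ²/n1) tr(Q̄_a⁻¹ Q1) + σ²`. -/
theorem pidual_risk_oracle_gates
    (n1 n2 d m : ℕ) (hn1 : 0 < n1) (hn2 : 0 < n2)
    (X : Matrix (Fin (n1 + n2)) (Fin d) ℝ)
    (A : Matrix (Fin (n1 + n2)) (Fin m) ℝ)
    (ws : Fin d → ℝ) (vs : Fin m → ℝ) (σ : ℝ) (hσ : 0 < σ)
    (γs : Matrix (Fin (n1 + n2)) (Fin (n1 + n2)) ℝ)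
    (hγs : γs = Matrix.diagonal (fun i : Fin (n1 + n2) =>
      if (i : ℕ) < n1 then (1 : ℝ) else 0))
    (Q1 : Matrix (Fin d) (Fin d) ℝ) (hQ1 : Q1 = Xᵀ * γs * X)
    (Xb : Matrix (Fin (n1 + n2)) (Fin d) ℝ) (hXb : Xb = γs * X)
    (Ab : Matrix (Fin (n1 + n2)) (Fin m) ℝ) (hAb : Ab = (1 - γs) * A)
    (hAinv : IsUnit (Abᵀ * Ab).det)
    (Pa : Matrix (Fin (n1 + n2)) (Fin (n1 + n2)) ℝ)
    (hPa : Pa = Ab * (Abᵀ * Ab)⁻¹ * Abᵀ)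
    (Xa : Matrix (Fin (n1 + n2)) (Fin d) ℝ) (hXa : Xa = (1 - Pa) * Xb)
    (Qa : Matrix (Fin d) (Fin d) ℝ) (hQa : Qa = Xaᵀ * Xa) (hQainv : IsUnit Qa.det)
    (H : Matrix (Fin d) (Fin (n1 + n2)) ℝ) (hH : H = Qa⁻¹ * Xaᵀ)
    (y : (Fin (n1 + n2) → ℝ) → Fin (n1 + n2) → ℝ)
    (hy : ∀ ε, y ε = (γs * X).mulVec ws + ((1 - γs) * A).mulVec vs + ε)
    (w1 : (Fin (n1 + n2) → ℝ) → Fin d → ℝ)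
    (hw1 : ∀ ε, w1 ε = H.mulVec (y ε))
    (R : (Fin d → ℝ) → ℝ)
    (hR : ∀ θ, R θ = ((1 : ℝ) / n1) * ∑ i, ((γs * X).mulVec (θ - ws) i) ^ 2 + σ ^ 2) :
    ∫ ε : Fin (n1 + n2) → ℝ, R (w1 ε)
      ∂(Measure.pi fun _ : Fin (n1 + n2) => gaussianReal 0 ⟨σ ^ 2, sq_nonneg σ⟩)
    = (σ ^ 2 / n1) * (Qa⁻¹ * Q1).trace + σ ^ 2 := by
  have hγt : γsᵀ = γs := by rw [hγs, diagonal_transpose]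
  have hγγ : γs * γs = γs := by
    rw [hγs, diagonal_mul_diagonal]
    simp
  have hPt : Paᵀ = Pa := by
    rw [hPa]
    simp [transpose_mul, transpose_nonsing_inv, Matrix.mul_assoc]
  have hPA : Pa * Ab = Ab := by
    rw [hPa, Matrix.mul_assoc, Matrix.mul_assoc, nonsing_inv_mul _ hAinv, Matrix.mul_one]
  have hPP : Pa * Pa = Pa := by
    nth_rw 2 [hPa]
    rw [← Matrix.mul_assoc, ← Matrix.mul_assoc, hPA, ← hPa]
  have hXat : Xaᵀ = Xbᵀ * (1 - Pa) := by
    rw [hXa, transpose_mul, transpose_sub, transpose_one, hPt]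
  have hXaXb : Xaᵀ * Xb = Qa := by
    have hproj : (1 - Pa) * (1 - Pa) = 1 - Pa := by
      rw [Matrix.mul_sub, Matrix.mul_one, Matrix.sub_mul, Matrix.one_mul, hPP, sub_self, sub_zero]
    rw [hQa, hXat, hXa, Matrix.mul_assoc, Matrix.mul_assoc, ← Matrix.mul_assoc (1 - Pa) (1 - Pa),
      hproj]
  have hHX : H * Xb = 1 := by
    rw [hH, Matrix.mul_assoc, hXaXb, nonsing_inv_mul _ hQainv]
  have hHA : H * Ab = 0 := by
    rw [hH, hXat, Matrix.mul_assoc, Matrix.mul_assoc, Matrix.sub_mul, hPA]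
    simp
  have hHH : H * Hᵀ = Qa⁻¹ := by
    have hQt : Qaᵀ = Qa := by rw [hQa, transpose_mul, transpose_transpose]
    rw [hH, transpose_mul, transpose_transpose, transpose_nonsing_inv, hQt, Matrix.mul_assoc,
      ← Matrix.mul_assoc Xaᵀ, ← hQa, mul_nonsing_inv _ hQainv, Matrix.mul_one]
  have hXX : Xbᵀ * Xb = Q1 := by
    rw [hXb, hQ1, transpose_mul, hγt, Matrix.mul_assoc, ← Matrix.mul_assoc γs, hγγ,
      Matrix.mul_assoc]
  have herr (ε) : w1 ε - ws = H *ᵥ ε := by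
    rw [hw1, hy, ← hXb, ← hAb, mulVec_add, mulVec_add, mulVec_mulVec, mulVec_mulVec, hHX, hHA]
    simp
  have htr : ((Xb * H) * (Xb * H)ᵀ).trace = (Qa⁻¹ * Q1).trace := by
    rw [transpose_mul, Matrix.mul_assoc, ← Matrix.mul_assoc H, hHH, trace_mul_comm,
      Matrix.mul_assoc, hXX]
  have hrisk (v : NNReal) (hv : (v : ℝ) = σ ^ 2) :
      ∫ ε, R (w1 ε) ∂(Measure.pi fun _ : Fin (n1 + n2) => gaussianReal 0 v) =
        (σ ^ 2 / n1) * (Qa⁻¹ * Q1).trace + σ ^ 2 := by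
    have hmoment := integral_sum_sq_mulVec_pi_gaussianReal (Xb * H) v
    simp only [hR, herr, ← hXb, mulVec_mulVec]
    rw [integral_add (hmoment.1.const_mul _) (integrable_const _), integral_const_mul, hmoment.2,
      htr, hv, integral_const, probReal_univ, one_smul]
    ring
  exact hrisk _ rfl
end
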